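/- No irreducible existential pattern P with |e(P)| > 1 is a var-elim pattern; that is, for every irreducible existential pattern P having at least two existential values, there exists an arc-consistent binary CSP instance I with a variable x and an injective value mapping m : e(P) → D(x) such that P does not occur at x with mapping m, I has a partial solution on all variables except x, but I has no solution. -/

import Mathlib

/-- A quantified pattern: a finite set `X` of variables (named by naturals), a finite
set `A ⊆ X × ℕ` of assignments (each variable having a nonempty domain), a partial
symmetric compatibility function `cpt` defined only on pairs of assignments to
distinct variables, a distinguished variable `vbar ∈ X`, a set `e` of existential
values of `vbar`, and an optional distinguished value `valbar ∈ e`.  A flat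
quantified pattern has `e = ∅` and an existential pattern has `e ≠ ∅`; patterns
without a distinguished value have `valbar = none`. -/
structure QPattern where
  X : Finset ℕ
  A : Finset (ℕ × ℕ)
  cpt : ℕ × ℕ → ℕ × ℕ → Option Bool
  cpt_symm : ∀ p q, cpt p q = cpt q p
  cpt_dom : ∀ p q, (cpt p q).isSome → p ∈ A ∧ q ∈ A ∧ p.1 ≠ q.1
  A_sub : ∀ p ∈ A, p.1 ∈ X
  dom_ne : ∀ v ∈ X, ∃ a, (v, a) ∈ A
  vbar : ℕ
  vbar_mem : vbar ∈ X
  e : Finset ℕ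
  e_sub : ∀ a ∈ e, (vbar, a) ∈ A
  valbar : Option ℕ
  valbar_mem : ∀ b, valbar = some b → b ∈ e

namespace QPattern

/-- A flat quantified pattern: no existential values. -/
def Flat (P : QPattern) : Prop := P.e = ∅

/-- An existential pattern: at least one existential value. -/
def Existential (P : QPattern) : Prop := P.e.Nonempty

/-- Values `a` and `b` of variable `v` are mergeable (`a` may be merged into `b`):
no assignment has defined and unequal compatibilities with `⟨v,a⟩` and `⟨v,b⟩`, and
if `a` is an existential value of the distinguished variable then so is `b`. -/
def Mergeable (P : QPattern) (v a b : ℕ) : Prop :=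
  (v, a) ∈ P.A ∧ (v, b) ∈ P.A ∧ a ≠ b ∧
  (∀ p, (P.cpt (v, a) p).isSome → (P.cpt (v, b) p).isSome →
    P.cpt (v, a) p = P.cpt (v, b) p) ∧
  (v = P.vbar → a ∈ P.e → b ∈ P.e)

/-- A dangling assignment: it appears in at most one defined compatibility, which
(if defined) is TRUE, and it is not an existential assignment of the distinguished
variable. -/
def Dangling (P : QPattern) (p : ℕ × ℕ) : Prop :=
  p ∈ P.A ∧
  (∀ q r, (P.cpt p q).isSome → (P.cpt p r).isSome → q = r) ∧
  (∀ q, (P.cpt p q).isSome → P.cpt p q = some true) ∧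
  ¬ (p.1 = P.vbar ∧ p.2 ∈ P.e)

/-- An irreducible pattern: no merge or dangling reduction can be performed. -/
def Irreducible (P : QPattern) : Prop :=
  (∀ v a b, ¬ P.Mergeable v a b) ∧ (∀ p, ¬ P.Dangling p)

/-- The merge reduction merging value `a` of variable `v` into value `b`:
the assignment `⟨v,a⟩` is deleted and its defined compatibilities are transferred
to `⟨v,b⟩` where previously undefined. -/
def MergeStep (P Q : QPattern) (v a b : ℕ) : Prop :=
  P.Mergeable v a b ∧
  Q.X = P.X ∧ Q.A = P.A.erase (v, a) ∧
  Q.vbar = P.vbar ∧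
  Q.e = (if v = P.vbar then P.e.erase a else P.e) ∧
  Q.valbar = (if v = P.vbar ∧ P.valbar = some a then some b else P.valbar) ∧
  (∀ p q, Q.cpt p q =
    if p = (v, a) ∨ q = (v, a) then none
    else if p = (v, b) ∧ P.cpt p q = none then P.cpt (v, a) q
    else if q = (v, b) ∧ P.cpt p q = none then P.cpt p (v, a)
    else P.cpt p q)

/-- The dangling reduction deleting a dangling assignment `p`. -/
def DanglingStep (P Q : QPattern) (p : ℕ × ℕ) : Prop :=
  P.Dangling p ∧
  Q.X = P.X ∧ Q.A = P.A.erase p ∧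
  Q.vbar = P.vbar ∧ Q.e = P.e ∧ Q.valbar = P.valbar ∧
  (∀ q r, Q.cpt q r = if q = p ∨ r = p then none else P.cpt q r)

/-- `ReducesTr P R tr`: `R` is obtained from `P` by a sequence of merge and dangling
reductions, and `tr` traces each (existential) value of the distinguished variable
of `P` to the value of the distinguished variable of `R` it has been merged into. -/
inductive ReducesTr : QPattern → QPattern → (ℕ → ℕ) → Prop
  | refl (P : QPattern) : ReducesTr P P id
  | merge {P Q R : QPattern} {v a b : ℕ} {tr : ℕ → ℕ} :
      MergeStep P Q v a b → ReducesTr Q R tr →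
      ReducesTr P R (fun c => tr (if v = P.vbar ∧ c = a then b else c))
  | dangling {P Q R : QPattern} {p : ℕ × ℕ} {tr : ℕ → ℕ} :
      DanglingStep P Q p → ReducesTr Q R tr → ReducesTr P R tr

/-- `IsEmbedding R Q fX fD`: the pattern `R` is equivalent, via the injective
renaming `fX` of variables and `fD` of assignments (assignment `(v,a)` being
renamed to `(fX v, fD v a)`), to a sub-pattern of `Q` (ignoring quantification). -/
def IsEmbedding (R Q : QPattern) (fX : ℕ → ℕ) (fD : ℕ → ℕ → ℕ) : Prop :=
  Set.InjOn fX ↑R.X ∧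
  (∀ v ∈ R.X, fX v ∈ Q.X) ∧
  (∀ p ∈ R.A, (fX p.1, fD p.1 p.2) ∈ Q.A) ∧
  (∀ v, Set.InjOn (fD v) {a | (v, a) ∈ R.A}) ∧
  (∀ p ∈ R.A, ∀ q ∈ R.A, (R.cpt p q).isSome →
    Q.cpt (fX p.1, fD p.1 p.2) (fX q.1, fD q.1 q.2) = R.cpt p q)

/-- The quantified pattern `P` occurs at variable `x` of `Q` with value mapping `m`:
some reduction `R` of `P` is equivalent to a sub-pattern of `Q`, the distinguished
variable of `R` corresponding to `x` and the values of `x` corresponding to the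
existential values of `P` being given by `m`. -/
def OccursAtWith (P Q : QPattern) (x : ℕ) (m : ℕ → ℕ) : Prop :=
  ∃ R tr, ReducesTr P R tr ∧
    ∃ fX fD, IsEmbedding R Q fX fD ∧ fX R.vbar = x ∧
      ∀ a ∈ P.e, fD R.vbar (tr a) = m a

/-- The quantified pattern `P` occurs in the quantified pattern `Q`: some reduction
of `P` is equivalent to a sub-pattern of `Q` (preserving the distinguished variable,
existential values and the distinguished value, as required of sub-patterns of
quantified patterns). -/
def OccursIn (P Q : QPattern) : Prop :=
  ∃ R tr, ReducesTr P R tr ∧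
    ∃ fX fD, IsEmbedding R Q fX fD ∧ fX R.vbar = Q.vbar ∧
      (∀ a ∈ R.e, fD R.vbar a ∈ Q.e) ∧
      (∀ b, R.valbar = some b → Q.valbar = some (fD R.vbar b))

/-- A binary CSP instance: a pattern whose compatibility function is total. -/
def IsInstance (Q : QPattern) : Prop :=
  ∀ p ∈ Q.A, ∀ q ∈ Q.A, p.1 ≠ q.1 → (Q.cpt p q).isSome

/-- Arc consistency: every assignment has a compatible assignment at every other
variable. -/
def ArcCons (Q : QPattern) : Prop :=
  ∀ p ∈ Q.A, ∀ w ∈ Q.X, w ≠ p.1 → ∃ b, (w, b) ∈ Q.A ∧ Q.cpt p (w, b) = some true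

/-- A partial solution on the set `Y` of variables. -/
def PartialSol (Q : QPattern) (Y : Finset ℕ) (s : ℕ → ℕ) : Prop :=
  (∀ v ∈ Y, (v, s v) ∈ Q.A) ∧
  ∀ v ∈ Y, ∀ w ∈ Y, v ≠ w → Q.cpt (v, s v) (w, s w) = some true

/-- A solution: a partial solution on all the variables. -/
def Sol (Q : QPattern) (s : ℕ → ℕ) : Prop :=
  Q.PartialSol Q.X s

/-- A variable elimination pattern: whenever `P` does not occur at a variable `x`
of an arc-consistent binary CSP instance for at least one injective value mapping,
the variable `x` can be eliminated (any partial solution on the other variables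
guarantees a solution). -/
def VarElimPattern (P : QPattern) : Prop :=
  ∀ Q : QPattern, Q.IsInstance → Q.ArcCons → ∀ x ∈ Q.X,
    (∃ m : ℕ → ℕ, Set.InjOn m ↑P.e ∧ (∀ a ∈ P.e, (x, m a) ∈ Q.A) ∧
      ¬ OccursAtWith P Q x m) →
    (∃ s, Q.PartialSol (Q.X.erase x) s) → ∃ s, Q.Sol s

/-- A value elimination pattern: whenever `P` (with distinguished value `b`) does
not occur at a variable `x` of an arc-consistent binary CSP instance for an
injective value mapping `m`, the value `m b` can be eliminated from the domain of
`x`: the instance obtained by deleting the assignment `⟨x, m b⟩` is satisfiable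
iff the original instance is.  (A solution of the instance with `⟨x, m b⟩` deleted
is exactly a solution `s` of the original instance with `s x ≠ m b`.) -/
def ValElimPattern (P : QPattern) : Prop :=
  ∀ Q : QPattern, Q.IsInstance → Q.ArcCons → ∀ x ∈ Q.X, ∀ m : ℕ → ℕ,
    Set.InjOn m ↑P.e → (∀ a ∈ P.e, (x, m a) ∈ Q.A) → ¬ OccursAtWith P Q x m →
    ∀ b, P.valbar = some b → ((∃ s, Q.Sol s ∧ s x ≠ m b) ↔ ∃ s, Q.Sol s)

/-- Two quantified patterns are equivalent: isomorphic via injective renamings of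
variables and assignments preserving domains, compatibilities, the distinguished
variable, the existential values and the distinguished value. -/
def EquivPat (P Q : QPattern) : Prop :=
  ∃ (fX : ℕ → ℕ) (fD : ℕ → ℕ → ℕ),
    Set.BijOn fX ↑P.X ↑Q.X ∧
    Set.BijOn (fun p : ℕ × ℕ => (fX p.1, fD p.1 p.2)) ↑P.A ↑Q.A ∧
    (∀ p ∈ P.A, ∀ q ∈ P.A,
      Q.cpt (fX p.1, fD p.1 p.2) (fX q.1, fD q.1 q.2) = P.cpt p q) ∧
    fX P.vbar = Q.vbar ∧
    Q.e = P.e.image (fD P.vbar) ∧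
    Q.valbar = P.valbar.map (fD P.vbar)

/-- `P'` is a sub-pattern of `P`. -/
def SubPat (P' P : QPattern) : Prop :=
  P'.X ⊆ P.X ∧ P'.A ⊆ P.A ∧
  (∀ p q, (P'.cpt p q).isSome → P'.cpt p q = P.cpt p q) ∧
  P'.vbar = P.vbar ∧ P'.e ⊆ P.e ∧
  (∀ b, P'.valbar = some b → P.valbar = some b)

end QPattern

/-- Partial compatibility function given by a finite list of (unordered) edges. -/
def ofList (l : List ((ℕ × ℕ) × (ℕ × ℕ) × Bool)) (p q : ℕ × ℕ) : Option Bool :=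
  (l.find? fun t => (t.1 == p && t.2.1 == q) || (t.1 == q && t.2.1 == p)).map (·.2.2)

theorem ofList_symm (l : List ((ℕ × ℕ) × (ℕ × ℕ) × Bool)) (p q : ℕ × ℕ) :
    ofList l p q = ofList l q p := by
  unfold ofList
  have h : (fun t : (ℕ × ℕ) × (ℕ × ℕ) × Bool =>
        (t.1 == p && t.2.1 == q) || (t.1 == q && t.2.1 == p))
      = (fun t => (t.1 == q && t.2.1 == p) || (t.1 == p && t.2.1 == q)) := by
    funext t; exact Bool.or_comm _ _
  rw [h]

theorem ofList_isSome {l : List ((ℕ × ℕ) × (ℕ × ℕ) × Bool)} {p q : ℕ × ℕ}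
    (h : (ofList l p q).isSome) :
    ∃ t ∈ l, (t.1 = p ∧ t.2.1 = q) ∨ (t.1 = q ∧ t.2.1 = p) := by
  unfold ofList at h
  cases hf : l.find? fun t => (t.1 == p && t.2.1 == q) || (t.1 == q && t.2.1 == p) with
  | none => rw [hf] at h; simp at h
  | some t =>
    refine ⟨t, List.mem_of_find?_eq_some hf, ?_⟩
    have hp := List.find?_some hf
    simp only [Bool.or_eq_true, Bool.and_eq_true, beq_iff_eq] at hp
    exact hp

namespace QPattern

/-- An irreducible pattern reduces only to itself, with the identity trace. -/
theorem Irreducible.eq_of_reducesTr {P R : QPattern} {tr : ℕ → ℕ} (hP : P.Irreducible)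
    (h : ReducesTr P R tr) : R = P ∧ tr = id := by
  cases h with
  | refl => exact ⟨rfl, rfl⟩
  | merge hs _ => exact absurd hs.1 (hP.1 _ _ _)
  | dangling hs _ => exact absurd hs.1 (hP.2 _)

/-- Two existential values of an irreducible pattern are separated by some assignment. -/
theorem Irreducible.exists_cpt_ne {P : QPattern} (hP : P.Irreducible) {a b : ℕ}
    (ha : a ∈ P.e) (hb : b ∈ P.e) (hab : a ≠ b) :
    ∃ p, (P.cpt (P.vbar, a) p).isSome ∧ (P.cpt (P.vbar, b) p).isSome ∧
      P.cpt (P.vbar, a) p ≠ P.cpt (P.vbar, b) p := by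
  by_contra! h
  exact hP.1 P.vbar a b ⟨P.e_sub a ha, P.e_sub b hb, hab, h, fun _ _ => hb⟩

/-- An irreducible pattern does not occur at `x` with a value mapping that sends two
existential values to values of `x` having the same compatibilities. -/
theorem Irreducible.not_occursAtWith {P Q : QPattern} (hP : P.Irreducible) {a b x : ℕ}
    {m : ℕ → ℕ} (ha : a ∈ P.e) (hb : b ∈ P.e) (hab : a ≠ b)
    (htwin : ∀ q, Q.cpt (x, m a) q = Q.cpt (x, m b) q) : ¬ OccursAtWith P Q x m := by
  rintro ⟨R, tr, hred, fX, fD, ⟨-, -, -, -, hcpt⟩, hx, hm⟩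
  obtain ⟨rfl, rfl⟩ := hP.eq_of_reducesTr hred
  obtain ⟨p, hap, hbp, hne⟩ := hP.exists_cpt_ne ha hb hab
  have hma : fD R.vbar a = m a := hm a ha
  have hmb : fD R.vbar b = m b := hm b hb
  have h₁ := hcpt _ (R.e_sub a ha) p (R.cpt_dom _ _ hap).2.1 hap
  have h₂ := hcpt _ (R.e_sub b hb) p (R.cpt_dom _ _ hbp).2.1 hbp
  simp only [hx, hma, hmb] at h₁ h₂
  exact hne (h₁.symm.trans ((htwin _).trans h₂))

/-- The instance on variables `0, 1, 2`, each with domain `insert 0 (S + 1)`, in which two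
assignments to distinct variables are compatible iff exactly one of their values is `0`:
the two-colouring problem of a triangle with one colour replicated. -/
def triangle (S : Finset ℕ) : QPattern where
  X := Finset.range 3
  A := Finset.range 3 ×ˢ insert 0 (S.image Nat.succ)
  cpt p q :=
    if (p ∈ Finset.range 3 ×ˢ insert 0 (S.image Nat.succ) ∧
        q ∈ Finset.range 3 ×ˢ insert 0 (S.image Nat.succ)) ∧ p.1 ≠ q.1 then
      some (decide (p.2 = 0) != decide (q.2 = 0))
    else none
  cpt_symm p q := by
    refine if_congr (and_congr and_comm ne_comm) ?_ rfl
    rw [bne_comm]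
  cpt_dom p q h := by
    by_contra hc
    rw [if_neg (by tauto)] at h
    simp at h
  A_sub p hp := (Finset.mem_product.1 hp).1
  dom_ne v hv := ⟨0, by simpa using hv⟩
  vbar := 0
  vbar_mem := by simp
  e := ∅
  e_sub := by simp
  valbar := none
  valbar_mem := by simp

theorem mem_triangle_A {S : Finset ℕ} {v c : ℕ} :
    (v, c) ∈ (triangle S).A ↔ v < 3 ∧ (c = 0 ∨ ∃ a ∈ S, a + 1 = c) := by
  simp [triangle]

theorem triangle_cpt {S : Finset ℕ} {p q : ℕ × ℕ} (hp : p ∈ (triangle S).A)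
    (hq : q ∈ (triangle S).A) (hpq : p.1 ≠ q.1) :
    (triangle S).cpt p q = some (decide (p.2 = 0) != decide (q.2 = 0)) :=
  if_pos ⟨⟨hp, hq⟩, hpq⟩

theorem triangle_cpt_eq_true {S : Finset ℕ} {p q : ℕ × ℕ} (hp : p ∈ (triangle S).A)
    (hq : q ∈ (triangle S).A) (hpq : p.1 ≠ q.1) :
    (triangle S).cpt p q = some true ↔ ¬ (p.2 = 0 ↔ q.2 = 0) := by
  rw [triangle_cpt hp hq hpq]
  simp

theorem triangle_cpt_succ {S : Finset ℕ} {a b v : ℕ} (ha : a ∈ S) (hb : b ∈ S)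
    (q : ℕ × ℕ) :
    (triangle S).cpt (v, a + 1) q = (triangle S).cpt (v, b + 1) q := by
  simp [triangle, ha, hb]

theorem triangle_isInstance (S : Finset ℕ) : (triangle S).IsInstance := fun p hp q hq hpq => by
  simp [triangle_cpt hp hq hpq]

theorem triangle_arcCons {S : Finset ℕ} {a : ℕ} (ha : a ∈ S) : (triangle S).ArcCons := by
  rintro ⟨v, c⟩ hp w hw hwv
  have hw : w < 3 := Finset.mem_range.1 hw
  have h₀ : (w, 0) ∈ (triangle S).A := mem_triangle_A.2 ⟨hw, .inl rfl⟩
  have h₁ : (w, a + 1) ∈ (triangle S).A := mem_triangle_A.2 ⟨hw, .inr ⟨a, ha, rfl⟩⟩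
  by_cases hc : c = 0
  · exact ⟨a + 1, h₁, (triangle_cpt_eq_true hp h₁ hwv.symm).2 (by simp [hc])⟩
  · exact ⟨0, h₀, (triangle_cpt_eq_true hp h₀ hwv.symm).2 (by simp [hc])⟩

theorem triangle_exists_partialSol {S : Finset ℕ} {a : ℕ} (ha : a ∈ S) :
    ∃ s, (triangle S).PartialSol ((triangle S).X.erase 0) s := by
  have hmem : ∀ v ∈ (triangle S).X.erase 0,
      (v, if v = 1 then 0 else a + 1) ∈ (triangle S).A := fun v hv =>
    mem_triangle_A.2 ⟨Finset.mem_range.1 (Finset.mem_of_mem_erase hv), by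
      split_ifs
      · exact .inl rfl
      · exact .inr ⟨a, ha, rfl⟩⟩
  refine ⟨fun v => if v = 1 then 0 else a + 1, hmem, fun v hv w hw hvw =>
    (triangle_cpt_eq_true (hmem v hv) (hmem w hw) hvw).2 ?_⟩
  simp only [triangle, Finset.mem_erase, Finset.mem_range] at hv hw
  grind

theorem triangle_not_sol (S : Finset ℕ) (s : ℕ → ℕ) : ¬ (triangle S).Sol s := by
  rintro ⟨hA, hs⟩
  have hX : ∀ v < 3, v ∈ (triangle S).X := fun v hv => Finset.mem_range.2 hv
  have key : ∀ v < 3, ∀ w < 3, v ≠ w → ¬ (s v = 0 ↔ s w = 0) := fun v hv w hw hvw =>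
    (triangle_cpt_eq_true (hA v (hX v hv)) (hA w (hX w hw)) hvw).1
      (hs v (hX v hv) w (hX w hw) hvw)
  have h₀₁ := key 0 (by simp) 1 (by simp) (by simp)
  have h₀₂ := key 0 (by simp) 2 (by simp) (by simp)
  have h₁₂ := key 1 (by simp) 2 (by simp) (by simp)
  tauto

end QPattern

/-- no irreducible existential pattern with more than one existential
value is a var-elim pattern: there is an arc-consistent binary CSP instance `I`,
a variable `x` of `I` and an injective value mapping `m` such that `P` does not
occur at `x` with mapping `m`, `I` has a partial solution on all variables except
`x`, but `I` has no solution. -/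
theorem no_var_elim_of_many_existentials (P : QPattern)
    (hirr : P.Irreducible) (hcard : 1 < P.e.card) :
    ∃ I : QPattern, I.IsInstance ∧ I.ArcCons ∧
      ∃ x ∈ I.X, ∃ m : ℕ → ℕ,
        Set.InjOn m ↑P.e ∧ (∀ a ∈ P.e, (x, m a) ∈ I.A) ∧
        ¬ QPattern.OccursAtWith P I x m ∧
        (∃ s, I.PartialSol (I.X.erase x) s) ∧
        ¬ ∃ s, I.Sol s := by
  obtain ⟨a, ha, b, hb, hab⟩ := Finset.one_lt_card.1 hcard
  exact ⟨QPattern.triangle P.e, QPattern.triangle_isInstance _, QPattern.triangle_arcCons ha,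
    0, Finset.mem_range.2 (by simp), Nat.succ, Nat.succ_injective.injOn,
    fun c hc => QPattern.mem_triangle_A.2 ⟨by simp, .inr ⟨c, hc, rfl⟩⟩,
    hirr.not_occursAtWith ha hb hab (QPattern.triangle_cpt_succ ha hb),
    QPattern.triangle_exists_partialSol ha, fun ⟨s, hs⟩ => QPattern.triangle_not_sol _ s hs⟩
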